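/- If a ∈ [0, log m − I(x*)], then ĉ = (1−θ)x*. If a ∈ (log m − I(x*), log m − I(θx*)), then ĉ ∈ (0, (1−θ)x*) and ĉ is the unique c ∈ (0, (1−θ)x*) satisfying G(c) = 0. -/

import Mathlib

open MeasureTheory Filter Set Topology

open scoped Classical in
/-- Cumulant generating function valued in `EReal` (equal to `+∞` where the
moment generating function is infinite). -/
noncomputable def cgfE {Ω : Type*} [MeasurableSpace Ω] (μ : Measure Ω) (X : Ω → ℝ) (t : ℝ) :
    EReal :=
  if Integrable (fun ω => Real.exp (t * X ω)) μ then
    ((Real.log (∫ ω, Real.exp (t * X ω) ∂μ) : ℝ) : EReal)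
  else ⊤

/-- Real-valued version of the cumulant generating function (meaningful where the
moment generating function is finite). -/
noncomputable def cgfR {Ω : Type*} [MeasurableSpace Ω] (μ : Measure Ω) (X : Ω → ℝ) (t : ℝ) :
    ℝ :=
  Real.log (∫ ω, Real.exp (t * X ω) ∂μ)

/-- The Cramér (Legendre) rate function `I(x) = sup_t (t x - Λ(t))`, valued in `[0,∞]`. -/
noncomputable def rateI {Ω : Type*} [MeasurableSpace Ω] (μ : Measure Ω) (X : Ω → ℝ) (x : ℝ) :
    EReal :=
  ⨆ t : ℝ, (((t * x : ℝ) : EReal) - cgfE μ X t)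

/-- `λ* = sup {λ ≥ 0 : E[exp(λ X)] < ∞}`, valued in `EReal`. -/
noncomputable def lamStar {Ω : Type*} [MeasurableSpace Ω] (μ : Measure Ω) (X : Ω → ℝ) :
    EReal :=
  sSup {l : EReal | ∃ lr : ℝ, l = (lr : EReal) ∧ 0 ≤ lr ∧
    Integrable (fun ω => Real.exp (lr * X ω)) μ}

/-- `x* = sup {x ≥ 0 : I(x) ≤ log m}`. -/
noncomputable def xStar {Ω : Type*} [MeasurableSpace Ω] (μ : Measure Ω) (X : Ω → ℝ)
    (m : ℝ) : ℝ :=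
  sSup {x : ℝ | 0 ≤ x ∧ rateI μ X x ≤ ((Real.log m : ℝ) : EReal)}

/-- `G(c) = log m − I(θx* + c) − a`, valued in `[-∞, ∞)`. -/
noncomputable def gBig {Ω : Type*} [MeasurableSpace Ω] (μ : Measure Ω) (X : Ω → ℝ)
    (m θ a c : ℝ) : EReal :=
  ((Real.log m : ℝ) : EReal) - rateI μ X (θ * xStar μ X m + c) - ((a : ℝ) : EReal)

/-- `ĉ = inf {c ≥ 0 : G(c) < 0}`. -/
noncomputable def cHat {Ω : Type*} [MeasurableSpace Ω] (μ : Measure Ω) (X : Ω → ℝ)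
    (m θ a : ℝ) : ℝ :=
  sInf {c : ℝ | 0 ≤ c ∧ gBig μ X m θ a c < 0}

section RateFunction

variable {Ω : Type*} [MeasurableSpace Ω] {μ : Measure Ω} {X : Ω → ℝ}

/-- A real bound on the rate function, unfolded into real inequalities. -/
theorem rateI_le_coe_iff {x A : ℝ} :
    rateI μ X x ≤ (A : EReal) ↔
      ∀ t : ℝ, Integrable (fun ω => Real.exp (t * X ω)) μ → t * x - cgfR μ X t ≤ A := by
  unfold rateI
  rw [iSup_le_iff]
  refine forall_congr' fun t => ?_
  by_cases h : Integrable (fun ω => Real.exp (t * X ω)) μ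
  · simp only [cgfE, cgfR, h, if_true, forall_const]
    rw [← EReal.coe_sub, EReal.coe_le_coe_iff]
  · simp [cgfE, h]

theorem rateI_convex {x y A B s : ℝ} (hs0 : 0 ≤ s) (hs1 : s ≤ 1)
    (hx : rateI μ X x ≤ (A : EReal)) (hy : rateI μ X y ≤ (B : EReal)) :
    rateI μ X ((1 - s) * x + s * y) ≤ (((1 - s) * A + s * B : ℝ) : EReal) := by
  rw [rateI_le_coe_iff] at *
  intro t ht
  nlinarith [mul_le_mul_of_nonneg_left (hx t ht) (sub_nonneg.2 hs1),
    mul_le_mul_of_nonneg_left (hy t ht) hs0]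

theorem isClosed_rateI_le (A : ℝ) : IsClosed {x : ℝ | rateI μ X x ≤ (A : EReal)} := by
  simp only [rateI_le_coe_iff, ofPred_forall]
  exact isClosed_iInter fun t => isClosed_iInter fun _ =>
    isClosed_le (by fun_prop) continuous_const

theorem rateI_nonneg [IsProbabilityMeasure μ] (x : ℝ) : 0 ≤ rateI μ X x := by
  refine le_trans (le_of_eq ?_) (le_iSup _ (0 : ℝ))
  simp [cgfE]

theorem rateI_zero_le [IsProbabilityMeasure μ] (hint : Integrable X μ)
    (hmean : ∫ ω, X ω ∂μ = 0) : rateI μ X 0 ≤ ((0 : ℝ) : EReal) := by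
  rw [rateI_le_coe_iff]
  intro t ht
  have h : ∫ ω, (t * X ω + 1) ∂μ ≤ ∫ ω, Real.exp (t * X ω) ∂μ :=
    integral_mono ((hint.const_mul t).add (integrable_const 1)) ht
      fun ω => Real.add_one_le_exp _
  rw [integral_add (hint.const_mul t) (integrable_const 1), integral_const_mul, hmean] at h
  have := Real.log_nonneg (x := ∫ ω, Real.exp (t * X ω) ∂μ) (by simpa using h)
  simpa [cgfR] using this

/-- Sublevel sets of the rate function are intervals. -/
theorem rateI_le_of_mem_Icc {x y z A : ℝ} (hx : rateI μ X x ≤ (A : EReal))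
    (hz : rateI μ X z ≤ (A : EReal)) (hxy : x ≤ y) (hyz : y ≤ z) :
    rateI μ X y ≤ (A : EReal) := by
  rw [rateI_le_coe_iff] at *
  intro t ht
  rcases le_total 0 t with h | h
  · exact le_trans (by gcongr) (hz t ht)
  · exact le_trans (sub_le_sub_right (mul_le_mul_of_nonpos_left hxy h) _) (hx t ht)

/-- Once the rate function has increased to a real level, it stays above this level. -/
theorem lt_rateI_of_lt {x y z J : ℝ} (hx : rateI μ X x < (J : EReal))
    (hy : rateI μ X y = (J : EReal)) (hxy : x < y) (hyz : y < z) :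
    (J : EReal) < rateI μ X z := by
  by_contra! hz
  obtain ⟨r, hxr, hrJ⟩ := EReal.lt_iff_exists_real_btwn.1 hx
  rw [EReal.coe_lt_coe_iff] at hrJ
  have hxz : 0 < z - x := by linarith
  have hs0 : 0 ≤ (y - x) / (z - x) := by apply div_nonneg <;> linarith
  have hs1 : (y - x) / (z - x) < 1 := by rw [div_lt_one hxz]; linarith
  have h := rateI_convex hs0 hs1.le hxr.le hz
  have e : (1 - (y - x) / (z - x)) * x + (y - x) / (z - x) * z = y := by
    field_simp
    ring
  rw [e, hy, EReal.coe_le_coe_iff] at h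
  nlinarith

/-- Intermediate values of the rate function are attained. -/
theorem exists_rateI_eq {p q J B : ℝ} (hpq : p ≤ q) (hp : rateI μ X p < (J : EReal))
    (hq : (J : EReal) < rateI μ X q) (hqB : rateI μ X q ≤ (B : EReal)) :
    ∃ z, p < z ∧ z < q ∧ rateI μ X z = (J : EReal) := by
  have hJB : J < B := EReal.coe_lt_coe_iff.1 (hq.trans_le hqB)
  obtain ⟨z, ⟨⟨hpz, hzq⟩, hz⟩, hmax⟩ :=
    (isCompact_Icc.inter_right (isClosed_rateI_le (μ := μ) (X := X) J)).exists_isGreatest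
      ⟨p, left_mem_Icc.2 hpq, hp.le⟩
  replace hz : rateI μ X z ≤ (J : EReal) := hz
  have hzq' : z < q := hzq.lt_of_ne fun h => (hz.trans_lt hq).ne (by rw [h])
  have hzJ : rateI μ X z = (J : EReal) := by
    by_contra hne
    obtain ⟨r, hzr, hrJ⟩ := EReal.lt_iff_exists_real_btwn.1 (lt_of_le_of_ne hz hne)
    rw [EReal.coe_lt_coe_iff] at hrJ
    have hrB : 0 < B - r := by linarith
    have hs0 : 0 < (J - r) / (B - r) := div_pos (by linarith) hrB
    have hs1 : (J - r) / (B - r) < 1 := by rw [div_lt_one hrB]; linarith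
    have h := rateI_convex hs0.le hs1.le hzr.le hqB
    have e : (1 - (J - r) / (B - r)) * r + (J - r) / (B - r) * B = J := by
      field_simp
      ring
    rw [e] at h
    have := hmax ⟨⟨by nlinarith, by nlinarith⟩, h⟩
    nlinarith
  exact ⟨z, hpz.lt_of_ne fun h => hp.ne (by rw [h, hzJ]), hzq', hzJ⟩

theorem rateI_xStar_le [IsProbabilityMeasure μ] (hint : Integrable X μ)
    (hmean : ∫ ω, X ω ∂μ = 0) {m : ℝ} (hm : 1 ≤ m)
    (hxB : BddAbove {x : ℝ | 0 ≤ x ∧ rateI μ X x ≤ ((Real.log m : ℝ) : EReal)}) :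
    rateI μ X (xStar μ X m) ≤ ((Real.log m : ℝ) : EReal) := by
  have hcl : IsClosed {x : ℝ | 0 ≤ x ∧ rateI μ X x ≤ ((Real.log m : ℝ) : EReal)} :=
    isClosed_Ici.inter (isClosed_rateI_le _)
  refine (hcl.csSup_mem ⟨0, le_rfl, (rateI_zero_le hint hmean).trans ?_⟩ hxB).2
  exact EReal.coe_le_coe_iff.2 (Real.log_nonneg hm)

theorem lt_rateI_of_xStar_lt {m x : ℝ} (hx0 : 0 ≤ x)
    (hxB : BddAbove {x : ℝ | 0 ≤ x ∧ rateI μ X x ≤ ((Real.log m : ℝ) : EReal)})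
    (hx : xStar μ X m < x) : ((Real.log m : ℝ) : EReal) < rateI μ X x := by
  by_contra! h
  exact hx.not_ge (le_csSup hxB ⟨hx0, h⟩)

theorem coe_lt_coe_sub_rateI_iff [IsProbabilityMeasure μ] {a b x : ℝ} :
    (a : EReal) < (b : EReal) - rateI μ X x ↔ rateI μ X x < ((b - a : ℝ) : EReal) := by
  have h0 := rateI_nonneg (μ := μ) (X := X) x
  induction h : rateI μ X x with
  | bot => simp [h] at h0
  | top => simp
  | coe r =>
    rw [← EReal.coe_sub, EReal.coe_lt_coe_iff, EReal.coe_lt_coe_iff]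
    constructor <;> intro <;> linarith

theorem coe_sub_rateI_lt_coe_iff [IsProbabilityMeasure μ] {a b x : ℝ} :
    (b : EReal) - rateI μ X x < (a : EReal) ↔ ((b - a : ℝ) : EReal) < rateI μ X x := by
  have h0 := rateI_nonneg (μ := μ) (X := X) x
  induction h : rateI μ X x with
  | bot => simp [h] at h0
  | top => simp [EReal.coe_lt_top, EReal.bot_lt_coe, -EReal.coe_sub]
  | coe r =>
    rw [← EReal.coe_sub, EReal.coe_lt_coe_iff, EReal.coe_lt_coe_iff]
    constructor <;> intro <;> linarith

theorem gBig_neg_iff [IsProbabilityMeasure μ] {m θ a c : ℝ} :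
    gBig μ X m θ a c < 0 ↔
      ((Real.log m - a : ℝ) : EReal) < rateI μ X (θ * xStar μ X m + c) := by
  rw [← coe_sub_rateI_lt_coe_iff, gBig,
    EReal.sub_lt_iff (Or.inl (EReal.coe_ne_bot a)) (Or.inl (EReal.coe_ne_top a)), zero_add]

theorem gBig_eq_zero_iff [IsProbabilityMeasure μ] {m θ a c : ℝ} :
    gBig μ X m θ a c = 0 ↔
      rateI μ X (θ * xStar μ X m + c) = ((Real.log m - a : ℝ) : EReal) := by
  have h0 := rateI_nonneg (μ := μ) (X := X) (θ * xStar μ X m + c)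
  unfold gBig
  induction h : rateI μ X (θ * xStar μ X m + c) with
  | bot => simp [h] at h0
  | top => simp [-EReal.coe_sub]
  | coe r =>
    rw [← EReal.coe_sub, ← EReal.coe_sub, ← EReal.coe_zero, EReal.coe_eq_coe_iff,
      EReal.coe_eq_coe_iff]
    constructor <;> intro <;> linarith

/-- `ĉ` is the point separating the values `I(θx* + c) ≤ log m - a` from the larger ones. -/
theorem cHat_eq_of_forall [IsProbabilityMeasure μ] {m θ a z : ℝ} (hz : 0 ≤ z)
    (hle : ∀ c, 0 ≤ c → c < z →
      rateI μ X (θ * xStar μ X m + c) ≤ ((Real.log m - a : ℝ) : EReal))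
    (hgt : ∀ c, z < c → ((Real.log m - a : ℝ) : EReal) < rateI μ X (θ * xStar μ X m + c)) :
    cHat μ X m θ a = z := by
  refine csInf_eq_of_forall_ge_of_forall_gt_exists_lt
    ⟨z + 1, by linarith, gBig_neg_iff.2 (hgt _ (by linarith))⟩ ?_ ?_
  · rintro c ⟨hc0, hc⟩
    by_contra! hcz
    exact (gBig_neg_iff.1 hc).not_ge (hle c hc0 hcz)
  · intro w hw
    obtain ⟨c, hzc, hcw⟩ := exists_between hw
    exact ⟨c, ⟨hz.trans hzc.le, gBig_neg_iff.2 (hgt c hzc)⟩, hcw⟩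

end RateFunction

theorem stmt14 {Ω : Type*} [MeasurableSpace Ω] (μ : Measure Ω) [IsProbabilityMeasure μ]
    (X : Ω → ℝ) (hmeas : Measurable X) (hint : Integrable X μ)
    (hmean : ∫ ω, X ω ∂μ = 0) (hX0 : μ {ω | X ω = 0} < 1)
    (hmom : ∃ κ : ℝ, 0 < κ ∧ Integrable (fun ω => Real.exp (κ * X ω)) μ)
    (m θ a : ℝ) (hm : 1 < m) (hθ0 : 0 ≤ θ) (hθ1 : θ < 1)
    (ha0 : 0 ≤ a) (ha : (a : EReal) < ((Real.log m : ℝ) : EReal) - rateI μ X (θ * xStar μ X m))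
    (hxB : BddAbove {x : ℝ | 0 ≤ x ∧ rateI μ X x ≤ ((Real.log m : ℝ) : EReal)})
    (hxpos : 0 < xStar μ X m) :
    ((a : EReal) ≤ ((Real.log m : ℝ) : EReal) - rateI μ X (xStar μ X m) →
      cHat μ X m θ a = (1 - θ) * xStar μ X m) ∧
    (((Real.log m : ℝ) : EReal) - rateI μ X (xStar μ X m) < (a : EReal) →
      (0 < cHat μ X m θ a ∧ cHat μ X m θ a < (1 - θ) * xStar μ X m ∧
        gBig μ X m θ a (cHat μ X m θ a) = 0 ∧
        ∀ c : ℝ, 0 < c → c < (1 - θ) * xStar μ X m → gBig μ X m θ a c = 0 →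
          c = cHat μ X m θ a)) := by
  have hθx : 0 ≤ θ * xStar μ X m := mul_nonneg hθ0 hxpos.le
  have hstar := rateI_xStar_le hint hmean hm.le hxB
  rw [coe_lt_coe_sub_rateI_iff] at ha
  refine ⟨fun h => ?_, fun h => ?_⟩
  · rw [← not_lt, coe_sub_rateI_lt_coe_iff, not_lt] at h
    refine cHat_eq_of_forall (mul_nonneg (by linarith) hxpos.le) (fun c hc0 hc => ?_)
      fun c hc => ?_
    · exact rateI_le_of_mem_Icc ha.le h (by linarith) (by linarith)
    · refine lt_of_le_of_lt (EReal.coe_le_coe_iff.2 (by linarith))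
        (lt_rateI_of_xStar_lt (by linarith) hxB (by linarith))
  · rw [coe_sub_rateI_lt_coe_iff] at h
    have key : ∀ c : ℝ, 0 < c → gBig μ X m θ a c = 0 → cHat μ X m θ a = c := by
      intro c hc0 hc
      rw [gBig_eq_zero_iff] at hc
      refine cHat_eq_of_forall hc0.le (fun d hd0 hd => ?_) fun d hd => ?_
      · exact rateI_le_of_mem_Icc ha.le hc.le (by linarith) (by linarith)
      · exact lt_rateI_of_lt ha hc (by linarith) (by linarith)
    obtain ⟨z, hpz, hzq, hz⟩ := exists_rateI_eq (by nlinarith) ha h hstar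
    have hzG : gBig μ X m θ a (z - θ * xStar μ X m) = 0 := by
      rw [gBig_eq_zero_iff, add_sub_cancel, hz]
    have hcz := key _ (by linarith) hzG
    rw [hcz]
    exact ⟨by linarith, by linarith, hzG, fun c hc0 _ hc => (key c hc0 hc).symm.trans hcz⟩
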